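/- Let k be a positive integer and set c_m := 2^(−1/6)·(πm)^(−1/3) and q_m(t) := c_m·cos 2πmt for m ∈ {k, k+1}. Then the Hessian quadratic form of ℬ restricted to V_k has the following properties: at q_{k+1}, the form ξ ↦ ⟨A_{q_{k+1}}ξ, ξ⟩ is negative definite on the 2-dimensional subspace spanned by cos 2πkt and sin 2πkt and satisfies ⟨A_{q_{k+1}}ξ, ξ⟩ ≥ 0 on the subspace spanned by cos 2π(k+1)t and sin 2π(k+1)t; at q_k, the form ξ ↦ ⟨A_{q_k}ξ, ξ⟩ satisfies ⟨A_{q_k}ξ, ξ⟩ ≥ 0 for all ξ ∈ V_k. In particular the Morse index of the restriction of ℬ to V_k is 2 at q_{k+1} and 0 at q_k. -/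

import Mathlib

open Real

/-- L² inner product of 1-periodic functions: `⟨f,g⟩ = ∫₀¹ f(t)g(t) dt`. -/
noncomputable def ip (f g : ℝ → ℝ) : ℝ := ∫ t in (0:ℝ)..1, f t * g t

/-- The amplitude `c_m = 2^(-1/6) (πm)^(-1/3)`. -/
noncomputable def ck (m : ℕ) : ℝ := 2 ^ (-(1:ℝ)/6) * (Real.pi * m) ^ (-(1:ℝ)/3)

/-- The critical point `q_m(t) = c_m cos 2πmt`. -/
noncomputable def qcrit (m : ℕ) : ℝ → ℝ := fun t => ck m * Real.cos (2 * π * m * t)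

/-- `α_q = ‖q̇‖²/‖q‖² − 1/(2‖q‖⁶)`, with `‖q‖² = ⟨q,q⟩`. -/
noncomputable def alphaQ (q : ℝ → ℝ) : ℝ :=
  ip (deriv q) (deriv q) / ip q q - 1 / (2 * (ip q q) ^ 3)

/-- The Hessian operator of `ℬ` at a critical point `q`:
`A_q ξ = −ξ̈ + α_q ξ − (2/‖q‖²)(2α_q − 1/‖q‖⁶)⟨q,ξ⟩ q`. -/
noncomputable def Hess (q ξ : ℝ → ℝ) : ℝ → ℝ := fun t =>
  -(deriv (deriv ξ) t) + alphaQ q * ξ t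
    - (2 / ip q q) * (2 * alphaQ q - 1 / (ip q q) ^ 3) * ip q ξ * q t

/-- A general element of the 4-dimensional space
`V_k = span{cos 2πkt, sin 2πkt, cos 2π(k+1)t, sin 2π(k+1)t}`. -/
noncomputable def qV (k : ℕ) (a b c d : ℝ) : ℝ → ℝ := fun t =>
  a * Real.cos (2 * π * k * t) + b * Real.sin (2 * π * k * t)
    + c * Real.cos (2 * π * (k + 1) * t) + d * Real.sin (2 * π * (k + 1) * t)

/-- A pure harmonic of nonzero integer frequency has mean zero over a period. -/
lemma integral_harmonic (n : ℕ) (hn : n ≠ 0) (p r : ℝ) :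
    ∫ t in (0:ℝ)..1, (p * cos (2 * π * n * t) + r * sin (2 * π * n * t)) = 0 := by
  have hn' : (n : ℝ) ≠ 0 := by exact_mod_cast hn
  have hderiv : ∀ t ∈ Set.uIcc (0:ℝ) 1, HasDerivAt
      (fun t => p * sin (2 * π * n * t) / (2 * π * n) - r * cos (2 * π * n * t) / (2 * π * n))
      (p * cos (2 * π * n * t) + r * sin (2 * π * n * t)) t := by
    intro t _
    have hlin : HasDerivAt (fun t : ℝ => 2 * π * n * t) (2 * π * n) t := by
      simpa using (hasDerivAt_id t).const_mul (2 * π * (n : ℝ))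
    refine (((hlin.sin.const_mul p).div_const (2 * π * n)).sub
      ((hlin.cos.const_mul r).div_const (2 * π * n))).congr_deriv ?_
    field_simp
    ring
  rw [intervalIntegral.integral_eq_sub_of_hasDerivAt hderiv
    (Continuous.intervalIntegrable (by fun_prop) _ _)]
  have hcos : cos (2 * π * n) = 1 := by
    rw [mul_comm]; exact cos_nat_mul_two_pi n
  have hsin : sin (2 * π * n) = 0 := by
    rw [show 2 * π * (n : ℝ) = ((2 * n : ℕ) : ℝ) * π by push_cast; ring]
    exact sin_nat_mul_pi _
  simp [hcos, hsin]

/-- The four trigonometric modes spanning `V_k` are orthogonal with squared norm `1/2`. -/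
lemma ip_qV (k : ℕ) (hk : 0 < k) (a b c d a' b' c' d' : ℝ) :
    ip (qV k a b c d) (qV k a' b' c' d') = (a * a' + b * b' + c * c' + d * d') / 2 := by
  let h (n : ℕ) (p r t : ℝ) : ℝ := p * cos (2 * π * n * t) + r * sin (2 * π * n * t)
  have hcont (n : ℕ) (p r : ℝ) : IntervalIntegrable (h n p r) MeasureTheory.volume 0 1 :=
    Continuous.intervalIntegrable (by fun_prop) _ _
  have hzero (n : ℕ) (hn : n ≠ 0) (p r : ℝ) : ∫ t in (0:ℝ)..1, h n p r t = 0 :=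
    integral_harmonic n hn p r
  have hprod (t : ℝ) : qV k a b c d t * qV k a' b' c' d' t =
      (a * a' + b * b' + c * c' + d * d') / 2
      + h (2 * k) ((a * a' - b * b') / 2) ((a * b' + b * a') / 2) t
      + h (2 * (k + 1)) ((c * c' - d * d') / 2) ((c * d' + d * c') / 2) t
      + h (2 * k + 1) ((a * c' + c * a' - b * d' - d * b') / 2)
          ((a * d' + d * a' + b * c' + c * b') / 2) t
      + h 1 ((a * c' + c * a' + b * d' + d * b') / 2)
          ((a * d' + d * a' - b * c' - c * b') / 2) t := by
    simp only [h, qV]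
    push_cast
    rw [show 2 * π * (2 * (k : ℝ)) * t = 2 * (2 * π * k * t) by ring,
      show 2 * π * (2 * ((k : ℝ) + 1)) * t = 2 * (2 * π * (k + 1) * t) by ring,
      show 2 * π * (2 * (k : ℝ) + 1) * t = 2 * π * (k + 1) * t + 2 * π * k * t by ring,
      show 2 * π * 1 * t = 2 * π * (k + 1) * t - 2 * π * k * t by ring]
    generalize 2 * π * ((k : ℝ) + 1) * t = v
    generalize 2 * π * (k : ℝ) * t = u
    rw [cos_two_mul, cos_two_mul, sin_two_mul, sin_two_mul, cos_add, cos_sub, sin_add, sin_sub]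
    linear_combination (b * b') * sin_sq_add_cos_sq u + (d * d') * sin_sq_add_cos_sq v
  unfold ip
  simp_rw [hprod]
  have hconst : IntervalIntegrable (fun _ : ℝ => (a * a' + b * b' + c * c' + d * d') / 2)
      MeasureTheory.volume 0 1 := intervalIntegrable_const
  rw [intervalIntegral.integral_add (((hconst.add (hcont _ _ _)).add (hcont _ _ _)).add
      (hcont _ _ _)) (hcont _ _ _),
    intervalIntegral.integral_add ((hconst.add (hcont _ _ _)).add (hcont _ _ _)) (hcont _ _ _),
    intervalIntegral.integral_add (hconst.add (hcont _ _ _)) (hcont _ _ _),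
    intervalIntegral.integral_add hconst (hcont _ _ _),
    hzero _ (by omega), hzero _ (by omega), hzero _ (by omega), hzero _ (by omega)]
  simp

lemma deriv_qV (k : ℕ) (a b c d : ℝ) :
    deriv (qV k a b c d) = qV k (2 * π * k * b) (-(2 * π * k * a))
      (2 * π * (k + 1) * d) (-(2 * π * (k + 1) * c)) := by
  funext t
  have hlin (w : ℝ) : HasDerivAt (fun t : ℝ => w * t) w t := by
    simpa using (hasDerivAt_id t).const_mul w
  have hsum := ((((hlin (2 * π * k)).cos.const_mul a).add
    ((hlin (2 * π * k)).sin.const_mul b)).add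
    ((hlin (2 * π * (k + 1))).cos.const_mul c)).add ((hlin (2 * π * (k + 1))).sin.const_mul d)
  refine Eq.trans (HasDerivAt.deriv hsum) ?_
  simp only [qV]
  ring

lemma qcrit_eq_qV (k : ℕ) : qcrit k = qV k (ck k) 0 0 0 := by
  funext t
  simp [qcrit, qV]

lemma qcrit_succ_eq_qV (k : ℕ) : qcrit (k + 1) = qV k 0 0 (ck (k + 1)) 0 := by
  funext t
  simp [qcrit, qV]

lemma ck_pow_six (m : ℕ) : ck m ^ 6 = 1 / (2 * (π * m) ^ 2) := by
  have hm : 0 ≤ π * (m : ℝ) := by positivity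
  have htwo : ((2 : ℝ) ^ (-(1:ℝ) / 6)) ^ 6 = 1 / 2 := by
    rw [← rpow_natCast, ← rpow_mul (by norm_num)]
    norm_num [rpow_neg_one]
  have hpi : ((π * (m : ℝ)) ^ (-(1:ℝ) / 3)) ^ 6 = ((π * m) ^ 2)⁻¹ := by
    rw [← rpow_natCast, ← rpow_mul hm,
      show -(1:ℝ) / 3 * (6 : ℕ) = -((2 : ℕ) : ℝ) by norm_num, rpow_neg hm, rpow_natCast]
  rw [ck, mul_pow, htwo, hpi]
  field_simp

lemma ck_pos (m : ℕ) (hm : 0 < m) : 0 < ck m := by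
  unfold ck
  positivity

lemma ip_qcrit_self (m : ℕ) (hm : 0 < m) : ip (qcrit m) (qcrit m) = ck m ^ 2 / 2 := by
  rw [qcrit_eq_qV, ip_qV m hm]
  ring

lemma one_div_ip_qcrit_cube (m : ℕ) (hm : 0 < m) :
    1 / ip (qcrit m) (qcrit m) ^ 3 = 16 * (π * m) ^ 2 := by
  have hm' : (0 : ℝ) < m := by exact_mod_cast hm
  rw [ip_qcrit_self m hm, div_pow, ← pow_mul, ck_pow_six]
  field_simp
  norm_num

lemma alphaQ_qcrit (m : ℕ) (hm : 0 < m) : alphaQ (qcrit m) = -(4 * (π * m) ^ 2) := by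
  have hc := ck_pos m hm
  have hcube := one_div_ip_qcrit_cube m hm
  have hkin : ip (deriv (qcrit m)) (deriv (qcrit m)) / ip (qcrit m) (qcrit m)
      = 4 * (π * m) ^ 2 := by
    rw [ip_qcrit_self m hm, qcrit_eq_qV, deriv_qV, ip_qV m hm]
    field_simp
    ring
  rw [alphaQ, hkin, ← div_div, div_right_comm, hcube]
  ring

lemma hess_qcrit (m : ℕ) (hm : 0 < m) (ξ : ℝ → ℝ) (t : ℝ) :
    Hess (qcrit m) ξ t = -(deriv (deriv ξ) t) - 4 * (π * m) ^ 2 * ξ t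
      + 96 * (π * m) ^ 2 / ck m ^ 2 * ip (qcrit m) ξ * qcrit m t := by
  have hc := ck_pos m hm
  rw [Hess, alphaQ_qcrit m hm, one_div_ip_qcrit_cube m hm, ip_qcrit_self m hm]
  field_simp
  ring

/-- The Hessian form at `q_k` on `V_k`, in coordinates. -/
lemma ip_hess_qcrit (k : ℕ) (hk : 0 < k) (a b c d : ℝ) :
    ip (Hess (qcrit k) (qV k a b c d)) (qV k a b c d) =
      24 * (π * k) ^ 2 * a ^ 2 + 2 * π ^ 2 * (2 * k + 1) * (c ^ 2 + d ^ 2) := by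
  have hc := ck_pos k hk
  have hH : Hess (qcrit k) (qV k a b c d) =
      qV k (48 * (π * k) ^ 2 * a) 0 (4 * π ^ 2 * (2 * k + 1) * c)
        (4 * π ^ 2 * (2 * k + 1) * d) := by
    funext t
    rw [hess_qcrit k hk, deriv_qV, deriv_qV, qcrit_eq_qV, ip_qV k hk]
    simp only [qV]
    field_simp
    ring
  rw [hH, ip_qV k hk]
  ring

/-- The Hessian form at `q_{k+1}` on `V_k`, in coordinates. -/
lemma ip_hess_qcrit_succ (k : ℕ) (hk : 0 < k) (a b c d : ℝ) :
    ip (Hess (qcrit (k + 1)) (qV k a b c d)) (qV k a b c d) =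
      24 * (π * (k + 1)) ^ 2 * c ^ 2 - 2 * π ^ 2 * (2 * k + 1) * (a ^ 2 + b ^ 2) := by
  have hc := ck_pos (k + 1) k.succ_pos
  have hH : Hess (qcrit (k + 1)) (qV k a b c d) =
      qV k (-(4 * π ^ 2 * (2 * k + 1) * a)) (-(4 * π ^ 2 * (2 * k + 1) * b))
        (48 * (π * (k + 1)) ^ 2 * c) 0 := by
    funext t
    rw [hess_qcrit (k + 1) k.succ_pos, deriv_qV, deriv_qV, qcrit_succ_eq_qV, ip_qV k hk]
    simp only [qV]
    push_cast
    field_simp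
    ring
  rw [hH, ip_qV k hk]
  ring

/-- Morse indices of the restriction of `ℬ` to `V_k`: at `q_{k+1}` the Hessian form is
negative definite on the mode-`k` plane and nonnegative on the mode-`(k+1)` plane
(index 2), and at `q_k` it is nonnegative on all of `V_k` (index 0). -/
theorem restricted_morse_indices (k : ℕ) (hk : 0 < k) :
    (∀ a b : ℝ, (a, b) ≠ (0, 0) →
      ip (Hess (qcrit (k + 1)) (qV k a b 0 0)) (qV k a b 0 0) < 0) ∧
    (∀ c d : ℝ,
      0 ≤ ip (Hess (qcrit (k + 1)) (qV k 0 0 c d)) (qV k 0 0 c d)) ∧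
    (∀ a b c d : ℝ,
      0 ≤ ip (Hess (qcrit k) (qV k a b c d)) (qV k a b c d)) := by
  refine ⟨fun a b hab => ?_, fun c d => ?_, fun a b c d => ?_⟩
  · rw [ip_hess_qcrit_succ k hk]
    have hsq : 0 < a ^ 2 + b ^ 2 := by
      by_cases ha : a = 0
      · have hb : b ≠ 0 := fun hb => hab (by rw [ha, hb])
        positivity
      · positivity
    have hpos : 0 < 2 * π ^ 2 * (2 * k + 1) * (a ^ 2 + b ^ 2) := by positivity
    linarith
  · rw [ip_hess_qcrit_succ k hk]
    have hnonneg : 0 ≤ 24 * (π * (k + 1)) ^ 2 * c ^ 2 := by positivity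
    linarith
  · rw [ip_hess_qcrit k hk]
    positivity
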